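/- Let M be a nonempty connected topological manifold of dimension n ≥ 2 (a Hausdorff, second-countable topological space in which every point has an open neighborhood homeomorphic to ℝⁿ), and let K ⊆ M be a compact, totally disconnected subset. Then M \ K is nonempty and connected. -/

import Mathlib

open Set Topology

/-- If neither of two disjoint closed sets separates two points of a simply connected space, then
their union does not separate them either. -/
theorem mem_connectedComponentIn_compl_union {X : Type*} [TopologicalSpace X]
    [SimplyConnectedSpace X] [LocallyPathConnectedSpace X] [NormalSpace X] {K L : Set X}
    (hK : IsClosed K) (hL : IsClosed L) (hKL : Disjoint K L) {x y : X}
    (hxK : y ∈ connectedComponentIn Kᶜ x) (hxL : y ∈ connectedComponentIn Lᶜ x) :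
    y ∈ connectedComponentIn (K ∪ L)ᶜ x := by
  classical
  by_contra hy
  have memx {C : Set X} (h : y ∈ connectedComponentIn C x) : x ∈ connectedComponentIn C x :=
    mem_connectedComponentIn (connectedComponentIn_nonempty_iff.1 ⟨y, h⟩)
  have hxU : x ∈ (K ∪ L)ᶜ := by
    rw [compl_union]
    exact ⟨connectedComponentIn_subset _ _ (memx hxK), connectedComponentIn_subset _ _ (memx hxL)⟩
  have hxA : x ∈ connectedComponentIn (K ∪ L)ᶜ x := mem_connectedComponentIn hxU
  have hopen : IsOpen (K ∪ L)ᶜ := (hK.union hL).isOpen_compl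
  set A := connectedComponentIn (K ∪ L)ᶜ x with hA
  have hAo : IsOpen A := hopen.connectedComponentIn
  have hfr : frontier A ⊆ K ∪ L := by
    intro z hz
    by_contra hzU
    have hzU' : z ∈ (K ∪ L)ᶜ := hzU
    rw [hAo.frontier_eq] at hz
    obtain ⟨w, hwz, hwA⟩ := mem_closure_iff.1 hz.1 (connectedComponentIn (K ∪ L)ᶜ z)
      hopen.connectedComponentIn (mem_connectedComponentIn hzU')
    apply hz.2
    rw [hA, connectedComponentIn_eq hwA, ← connectedComponentIn_eq hwz]
    exact mem_connectedComponentIn hzU'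
  obtain ⟨φ, hφK, hφL, -⟩ := exists_continuous_zero_one_of_isClosed hK hL hKL
  let g : X → ℝ := A.piecewise (fun z ↦ φ z / 2) (fun z ↦ -φ z / 2)
  let h : X → ℝ := A.piecewise (fun z ↦ φ z / 2) (fun z ↦ 1 - φ z / 2)
  have hg : ContinuousOn g Lᶜ := by
    refine ContinuousOn.piecewise (fun z hz ↦ ?_) (by fun_prop) (by fun_prop)
    have : φ z = 0 := hφK ((hfr hz.2).resolve_right hz.1)
    simp [this]
  have hh : ContinuousOn h Kᶜ := by
    refine ContinuousOn.piecewise (fun z hz ↦ ?_) (by fun_prop) (by fun_prop)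
    have : φ z = 1 := hφL ((hfr hz.2).resolve_left hz.1)
    simp only [this]
    norm_num
  have hgh (z : X) : (h z : AddCircle (1 : ℝ)) = g z := by
    by_cases hz : z ∈ A
    · simp [g, h, hz]
    · have : h z = g z + 1 := by simp [g, h, hz]; ring
      rw [this, AddCircle.coe_add_period]
  let f : C(X, AddCircle (1 : ℝ)) := ⟨fun z ↦ g z, by
    refine continuous_iff_continuousAt.2 fun z ↦ ?_
    by_cases hz : z ∈ L
    · simp_rw [← hgh]
      exact (AddCircle.continuous_mk' 1).continuousAt.comp
        (hh.continuousAt (hK.isOpen_compl.mem_nhds (hKL.notMem_of_mem_right hz)))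
    · exact (AddCircle.continuous_mk' 1).continuousAt.comp
        (hg.continuousAt (hL.isOpen_compl.mem_nhds hz))⟩
  obtain ⟨F, ⟨-, hF⟩, -⟩ :=
    (AddCircle.isCoveringMap_coe (1 : ℝ)).existsUnique_continuousMap_lifts f x (g x) rfl
  have hZ : IsDiscrete (range ((↑) : ℤ → ℝ)) :=
    Int.isClosedEmbedding_coe_real.isEmbedding.isDiscrete_range
  have key {k : X → ℝ} (hk : ∀ z, (k z : AddCircle (1 : ℝ)) = g z) {C : Set X}
      (hkC : ContinuousOn k C) (hxy : y ∈ connectedComponentIn C x) :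
      F x - k x = F y - k y := by
    refine isPreconnected_connectedComponentIn.constant_of_mapsTo (f := fun z ↦ F z - k z) hZ
      (F.continuous.continuousOn.sub (hkC.mono (connectedComponentIn_subset _ _)))
      (fun z _ ↦ ?_) (memx hxy) hxy
    have h1 : (F z : AddCircle (1 : ℝ)) = k z := (congrFun hF z).trans (hk z).symm
    rw [← sub_eq_zero, ← AddCircle.coe_sub, AddCircle.coe_eq_zero_iff] at h1
    obtain ⟨m, hm⟩ := h1
    exact ⟨m, by simpa using hm⟩
  have h1 := key (fun _ ↦ rfl) hg hxL
  have h2 := key hgh hh hxK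
  simp only [g, h, piecewise_eq_of_mem _ _ _ hxA, piecewise_eq_of_notMem _ _ _ hy] at h1 h2
  linarith

/-- The complement of a closed ball in a real normed space of dimension at least two is
preconnected. -/
theorem isPreconnected_compl_closedBall {E : Type*} [NormedAddCommGroup E] [NormedSpace ℝ E]
    (h : 1 < Module.rank ℝ E) (q : E) {r : ℝ} (hr : 0 ≤ r) :
    IsPreconnected (Metric.closedBall q r)ᶜ := by
  have himage : (fun v : E ↦ q + (1 + r / ‖v‖) • v) '' {0}ᶜ = (Metric.closedBall q r)ᶜ := by
    ext w
    simp only [mem_image, mem_compl_iff, mem_singleton_iff, Metric.mem_closedBall, not_le,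
      dist_eq_norm]
    constructor
    · rintro ⟨v, hv, rfl⟩
      have hv' : 0 < ‖v‖ := norm_pos_iff.2 hv
      rw [add_sub_cancel_left, norm_smul, Real.norm_of_nonneg (by positivity)]
      field_simp
      linarith
    · intro hw
      have hw' : 0 < ‖w - q‖ := hr.trans_lt hw
      have hc : 0 < 1 - r / ‖w - q‖ := by rw [sub_pos, div_lt_one hw']; exact hw
      have hne : ‖w - q‖ - r ≠ 0 := by linarith
      refine ⟨(1 - r / ‖w - q‖) • (w - q), smul_ne_zero hc.ne' (norm_pos_iff.1 hw'), ?_⟩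
      have h1 : (1 + r / ‖(1 - r / ‖w - q‖) • (w - q)‖) * (1 - r / ‖w - q‖) = 1 := by
        rw [norm_smul, Real.norm_of_nonneg hc.le]
        field_simp
        ring
      rw [smul_smul, h1, one_smul, add_sub_cancel]
  rw [← himage]
  refine (isConnected_compl_singleton_of_one_lt_rank h 0).isPreconnected.image _ ?_
  refine continuousOn_const.add (ContinuousOn.smul (continuousOn_const.add ?_) continuousOn_id)
  exact continuousOn_const.div continuous_norm.continuousOn fun v hv ↦ norm_ne_zero_iff.2 hv

/-- A closed totally disconnected subset of a finite dimensional real normed space of dimension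
at least two does not separate the space. -/
theorem IsTotallyDisconnected.isPreconnected_compl_of_one_lt_rank {E : Type*}
    [NormedAddCommGroup E] [NormedSpace ℝ E] [FiniteDimensional ℝ E] (h : 1 < Module.rank ℝ E)
    {C : Set E} (hC : IsClosed C) (hCd : IsTotallyDisconnected C) : IsPreconnected Cᶜ := by
  have := FiniteDimensional.proper ℝ E
  refine isPreconnected_of_forall_pair fun x hx y hy ↦ ?_
  suffices y ∈ connectedComponentIn Cᶜ x from
    ⟨_, connectedComponentIn_subset _ _, mem_connectedComponentIn hx, this,
      isPreconnected_connectedComponentIn⟩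
  have : TotallyDisconnectedSpace C := totallyDisconnectedSpace_subtype_iff.2 hCd
  have : LocallyCompactSpace C := hC.locallyCompactSpace
  have hemb := hC.isClosedEmbedding_subtypeVal
  have hsmall (c : C) : ∃ V : Set C, IsClopen V ∧ c ∈ V ∧
      y ∈ connectedComponentIn (Subtype.val '' V)ᶜ x := by
    obtain ⟨r, hr, hrs⟩ := Metric.nhds_basis_closedBall.mem_iff.1
      (((finite_singleton y).insert x).isClosed.isOpen_compl.mem_nhds
        (show (c : E) ∈ ({x, y} : Set E)ᶜ by
          rintro (hc | hc)
          · exact hx (hc ▸ c.2)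
          · exact hy (mem_singleton_iff.1 hc ▸ c.2)))
    obtain ⟨V, hV, hcV, hVr⟩ := loc_compact_Haus_tot_disc_of_zero_dim.mem_nhds_iff.1
      (continuous_subtype_val.continuousAt.preimage_mem_nhds
        (Metric.closedBall_mem_nhds (c : E) hr))
    refine ⟨V, hV, hcV, (isPreconnected_compl_closedBall h c hr.le).subset_connectedComponentIn
      (fun hxr ↦ hrs hxr (by simp)) ?_ fun hyr ↦ hrs hyr (by simp)⟩
    exact compl_subset_compl.2 (image_subset_iff.2 hVr)
  choose V hV hcV hVsep using hsmall
  set R := max ‖x‖ ‖y‖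
  have hxR : x ∈ Metric.closedBall 0 R := by simp [R]
  have hyR : y ∈ Metric.closedBall 0 R := by simp [R]
  have hball : y ∈ connectedComponentIn (Metric.closedBall 0 R) x :=
    Metric.isPreconnected_closedBall.subset_connectedComponentIn hxR subset_rfl hyR
  obtain ⟨t, ht⟩ := (hemb.isCompact_preimage (isCompact_closedBall 0 R)).elim_finite_subcover V
    (fun c ↦ (hV c).isOpen) fun c _ ↦ mem_iUnion.2 ⟨c, hcV c⟩
  have hunion {P Q : Set C} (hP : IsClopen P) (hQ : IsClopen Q)
      (hyP : y ∈ connectedComponentIn (Subtype.val '' P)ᶜ x)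
      (hyQ : y ∈ connectedComponentIn (Subtype.val '' (Q \ P))ᶜ x) :
      y ∈ connectedComponentIn (Subtype.val '' (P ∪ Q))ᶜ x := by
    rw [← union_sdiff_self, image_union]
    exact mem_connectedComponentIn_compl_union (hemb.isClosedMap _ hP.isClosed)
      (hemb.isClosedMap _ (hQ.diff hP).isClosed)
      ((disjoint_image_iff Subtype.val_injective).2 disjoint_sdiff_right) hyP hyQ
  have hfin (s : Finset C) : y ∈ connectedComponentIn (Subtype.val '' (⋃ c ∈ s, V c))ᶜ x := by
    classical
    induction s using Finset.induction_on with
    | empty => simp [connectedComponentIn_univ, PreconnectedSpace.connectedComponent_eq_univ]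
    | insert c s _ ih =>
      rw [Finset.set_biUnion_insert, union_comm]
      exact hunion (isClopen_biUnion_finset fun c _ ↦ hV c) (hV c) ih
        (connectedComponentIn_mono _ (compl_subset_compl.2 (image_mono sdiff_subset)) (hVsep c))
  have := hunion (isClopen_biUnion_finset fun c _ ↦ hV c) isClopen_univ (hfin t)
    (connectedComponentIn_mono _ (fun z hz ↦ by
      rintro ⟨c, hc, rfl⟩
      exact hc.2 (ht hz)) hball)
  simpa using this

/-- A totally disconnected subset of a nontrivial real normed space has dense complement. -/
theorem IsTotallyDisconnected.dense_compl {E : Type*} [NormedAddCommGroup E] [NormedSpace ℝ E]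
    [Nontrivial E] {C : Set E} (hC : IsTotallyDisconnected C) : Dense Cᶜ := by
  rw [← interior_eq_empty_iff_dense_compl, eq_empty_iff_forall_notMem]
  intro v hv
  obtain ⟨r, hr, hrC⟩ := Metric.mem_nhds_iff.1 (mem_interior_iff_mem_nhds.1 hv)
  have := (hC _ hrC Metric.isPreconnected_ball).eq_singleton_of_mem (Metric.mem_ball_self hr)
  exact not_isOpen_singleton v (this ▸ Metric.isOpen_ball)

/-- A set with dense complement whose complement is preconnected near every point of a connected
space has connected complement. -/
theorem Dense.isConnected_of_forall_isPreconnected_inter {X : Type*} [TopologicalSpace X]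
    [ConnectedSpace X] {s : Set X} (hs : Dense s)
    (hloc : ∀ x, ∃ U : Set X, IsOpen U ∧ x ∈ U ∧ IsPreconnected (U ∩ s)) : IsConnected s := by
  obtain ⟨x, hx⟩ := hs.nonempty
  set A := connectedComponentIn s x
  have habs {U : Set X} (hU : IsOpen U) (hUs : IsPreconnected (U ∩ s)) {p : X} (hp : p ∈ U)
      (hpA : p ∈ closure A) : U ∩ s ⊆ A := by
    obtain ⟨w, hwU, hwA⟩ := mem_closure_iff.1 hpA U hU hp
    rw [show A = connectedComponentIn s w from connectedComponentIn_eq hwA]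
    exact hUs.subset_connectedComponentIn ⟨hwU, connectedComponentIn_subset _ _ hwA⟩
      inter_subset_right
  have hopen : IsOpen (closure A) := by
    refine isOpen_iff_mem_nhds.2 fun p hp ↦ ?_
    obtain ⟨U, hU, hpU, hUs⟩ := hloc p
    refine Filter.mem_of_superset (hU.mem_nhds hpU) ?_
    exact (hs.open_subset_closure_inter hU).trans (closure_mono (habs hU hUs hpU hp))
  have huniv : closure A = univ := IsClopen.eq_univ ⟨isClosed_closure, hopen⟩
    ⟨x, subset_closure (mem_connectedComponentIn hx)⟩
  have hsA : s = A := by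
    refine subset_antisymm (fun y hy ↦ ?_) (connectedComponentIn_subset _ _)
    obtain ⟨U, hU, hyU, hUs⟩ := hloc y
    exact habs hU hUs hyU (huniv ▸ mem_univ y) ⟨hyU, hy⟩
  exact ⟨⟨x, hx⟩, hsA ▸ isPreconnected_connectedComponentIn⟩

/-- Let `M` be a nonempty connected topological manifold of
dimension `n ≥ 2` (Hausdorff, second countable, and locally homeomorphic to
`ℝⁿ`), and let `K ⊆ M` be a compact, totally disconnected subset. Then
`M \ K` is nonempty and connected. -/
theorem complement_of_compact_totally_disconnected_connected
    {M : Type*} [TopologicalSpace M] [T2Space M] [SecondCountableTopology M]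
    [ConnectedSpace M] (n : ℕ) (hn : 2 ≤ n)
    (hloc : ∀ x : M, ∃ U : Set M, IsOpen U ∧ x ∈ U ∧ Nonempty (U ≃ₜ (Fin n → ℝ)))
    (K : Set M) (hK : IsCompact K) (hKdisc : IsTotallyDisconnected K) :
    IsConnected Kᶜ := by
  have : Nonempty (Fin n) := ⟨⟨0, by omega⟩⟩
  have hrank : 1 < Module.rank ℝ (Fin n → ℝ) := by
    rw [rank_fin_fun]
    exact_mod_cast hn
  have hchart {U : Set M} (e : U ≃ₜ (Fin n → ℝ)) :
      IsClosed {v | (e.symm v : M) ∈ K} ∧ IsTotallyDisconnected {v | (e.symm v : M) ∈ K} := by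
    have hemb : IsEmbedding fun v ↦ (e.symm v : M) := IsEmbedding.subtypeVal.comp e.symm.isEmbedding
    refine ⟨hK.isClosed.preimage hemb.continuous, hemb.isTotallyDisconnected ?_⟩
    exact fun t ht ↦ hKdisc t (ht.trans (image_preimage_subset _ K))
  refine Dense.isConnected_of_forall_isPreconnected_inter (fun p ↦ ?_) fun p ↦ ?_
  · obtain ⟨U, -, hpU, ⟨e⟩⟩ := hloc p
    have := map_mem_closure (f := fun v ↦ (e.symm v : M)) (by fun_prop)
      ((hchart e).2.dense_compl (e ⟨p, hpU⟩)) (t := Kᶜ) fun v hv ↦ hv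
    simpa using this
  · obtain ⟨U, hU, hpU, ⟨e⟩⟩ := hloc p
    refine ⟨U, hU, hpU, ?_⟩
    convert! ((hchart e).2.isPreconnected_compl_of_one_lt_rank hrank (hchart e).1).image
      (fun v ↦ (e.symm v : M)) (by fun_prop) using 1
    ext z
    constructor
    · rintro ⟨hzU, hzK⟩
      exact ⟨e ⟨z, hzU⟩, by simpa using hzK, by simp⟩
    · rintro ⟨v, hv, rfl⟩
      exact ⟨(e.symm v).2, hv⟩
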